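/- arXiv:1101.3971 — 12 statements merged into one kernel-verified Lean document; each statement's English description precedes it below -/
import Mathlib

section
/- There exists a finite group G of order 32 that admits a class preserving automorphism which is not inner. -/
/-- The group of affine maps `x ↦ unit * x + shift` of `ZMod 8`, that is, the holomorph of the
cyclic group of order 8. -/
@[ext]
structure AffineZModEight where
  shift : ZMod 8
  unit : (ZMod 8)ˣ

namespace AffineZModEight

instance : Group AffineZModEight :=
  { mul := fun x y => ⟨x.shift + x.unit * y.shift, x.unit * y.unit⟩
    one := ⟨0, 1⟩
    inv := fun x => ⟨-(x.unit⁻¹ * x.shift : ZMod 8), x.unit⁻¹⟩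
    mul_assoc := fun x y z => AffineZModEight.ext
      (show x.shift + x.unit * y.shift + ((x.unit * y.unit : (ZMod 8)ˣ) : ZMod 8) * z.shift =
        x.shift + x.unit * (y.shift + y.unit * z.shift) by push_cast; ring)
      (mul_assoc x.unit y.unit z.unit)
    one_mul := fun x => AffineZModEight.ext
      (show 0 + ((1 : (ZMod 8)ˣ) : ZMod 8) * x.shift = x.shift by simp) (one_mul x.unit)
    mul_one := fun x => AffineZModEight.ext
      (show x.shift + x.unit * 0 = x.shift by simp) (mul_one x.unit)
    inv_mul_cancel := fun x => AffineZModEight.ext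
      (show -(x.unit⁻¹ * x.shift : ZMod 8) + ((x.unit⁻¹ : (ZMod 8)ˣ) : ZMod 8) * x.shift = 0 by
        simp)
      (inv_mul_cancel x.unit) }

@[simp]
theorem shift_mul (x y : AffineZModEight) : (x * y).shift = x.shift + x.unit * y.shift := rfl

@[simp]
theorem unit_mul (x y : AffineZModEight) : (x * y).unit = x.unit * y.unit := rfl

theorem card_eq : Nat.card AffineZModEight = 32 := by
  have e : AffineZModEight ≃ ZMod 8 × (ZMod 8)ˣ :=
    { toFun := fun x => (x.shift, x.unit)
      invFun := fun p => ⟨p.1, p.2⟩ }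
  rw [Nat.card_congr e, Nat.card_prod, Nat.card_zmod, Nat.card_eq_fintype_card,
    ZMod.card_units_eq_totient]
  decide

/-- The 1-cocycle of `(ZMod 8)ˣ` with values in `ZMod 8` which is `4` at `3` and `5`, and `0` at
`1` and `7`. -/
def cocycle (u : (ZMod 8)ˣ) : ZMod 8 :=
  if (u : ZMod 8) = 3 ∨ (u : ZMod 8) = 5 then 4 else 0

theorem cocycle_mul : ∀ u v : (ZMod 8)ˣ, cocycle (u * v) = cocycle u + u * cocycle v := by
  decide

theorem exists_cocycle_eq : ∀ u : (ZMod 8)ˣ, ∃ b : ZMod 8, cocycle u + u * b = b := by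
  decide

theorem not_exists_forall_cocycle_eq :
    ¬ ∃ b : ZMod 8, ∀ u : (ZMod 8)ˣ, b + cocycle u = u * b := by
  decide

/-- The automorphism that translates `shift` by the cocycle. -/
def cocycleAut : AffineZModEight ≃* AffineZModEight where
  toFun x := ⟨x.shift + cocycle x.unit, x.unit⟩
  invFun x := ⟨x.shift - cocycle x.unit, x.unit⟩
  left_inv x := by ext <;> simp
  right_inv x := by ext <;> simp
  map_mul' x y := by
    ext
    · simp only [shift_mul, unit_mul, cocycle_mul]
      ring
    · rfl

@[simp]
theorem shift_cocycleAut (x : AffineZModEight) :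
    (cocycleAut x).shift = x.shift + cocycle x.unit := rfl

@[simp]
theorem unit_cocycleAut (x : AffineZModEight) : (cocycleAut x).unit = x.unit := rfl

theorem isConj_cocycleAut (x : AffineZModEight) : IsConj x (cocycleAut x) := by
  obtain ⟨b, hb⟩ := exists_cocycle_eq x.unit
  refine isConj_iff.2 ⟨⟨b, 1⟩, mul_inv_eq_iff_eq_mul.2 ?_⟩
  ext
  · simp only [shift_mul, shift_cocycleAut, unit_cocycleAut, Units.val_one]
    linear_combination -hb
  · simp

theorem cocycleAut_not_inner :
    ¬ ∃ g : AffineZModEight, ∀ x, cocycleAut x = g⁻¹ * x * g := by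
  rintro ⟨g, hg⟩
  have key (x : AffineZModEight) : g.shift + g.unit * (x.shift + cocycle x.unit) =
      x.shift + x.unit * g.shift := by
    have h : g * cocycleAut x = x * g := by rw [hg x]; group
    simpa using congrArg shift h
  have h_unit : (g.unit : ZMod 8) = 1 := by
    have h := key ⟨1, 1⟩
    have h1 : cocycle 1 = 0 := by decide
    simp only [h1, Units.val_one] at h
    linear_combination h
  refine not_exists_forall_cocycle_eq ⟨g.shift, fun u => ?_⟩
  have h := key ⟨0, u⟩
  simp only [h_unit] at h
  linear_combination h

end AffineZModEight

/-- There exists a finite group `G` of order 32 that admits a class preserving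
automorphism which is not inner. -/
theorem exists_order32_noninner_class_preserving :
    ∃ (G : Type) (_ : Group G), Nat.card G = 32 ∧
      ∃ α : G ≃* G, (∀ x : G, IsConj x (α x)) ∧
        ¬ ∃ g : G, ∀ x : G, α x = g⁻¹ * x * g :=
  ⟨AffineZModEight, inferInstance, AffineZModEight.card_eq, AffineZModEight.cocycleAut,
    AffineZModEight.isConj_cocycleAut, AffineZModEight.cocycleAut_not_inner⟩
end

section
/- Let p be a prime and let G be a group of order pⁿ with n ≥ 3 such that the center Z(G) has order p^(n−2). Then every class preserving automorphism of G is inner. -/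
/-- Above a subgroup of index `p ^ 2` there are no chains of length two that stop short of `⊤`. -/
theorem Subgroup.eq_top_of_lt_of_lt_of_index_eq_prime_sq {G : Type*} [Group G] {p : ℕ}
    (hp : p.Prime) {Z A B : Subgroup G} (hZ : Z.index = p ^ 2) (hZA : Z < A) (hAB : A < B) :
    B = ⊤ := by
  have h1 : Z.relIndex A * A.index = p ^ 2 := by
    rw [Subgroup.relIndex_mul_index hZA.le, hZ]
  have h2 : A.relIndex B * B.index = A.index := Subgroup.relIndex_mul_index hAB.le
  have h3 : Z.relIndex A ≠ 1 := fun h => hZA.not_ge (Subgroup.relIndex_eq_one.1 h)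
  have h4 : A.relIndex B ≠ 1 := fun h => hAB.not_ge (Subgroup.relIndex_eq_one.1 h)
  have key {m : ℕ} (hm : m ∣ p ^ 2) (hm1 : m ≠ 1) : p ∣ m := by
    obtain ⟨k, -, rfl⟩ := (Nat.dvd_prime_pow hp).1 hm
    exact dvd_pow_self p fun hk => hm1 (by rw [hk, pow_zero])
  obtain ⟨a, ha⟩ := key (Dvd.intro _ h1) h3
  obtain ⟨b, hb⟩ := key ((Dvd.intro _ h2).trans (Dvd.intro_left _ h1)) h4
  rw [← h2, ha, hb] at h1
  have h5 : p ^ 2 * (a * b * B.index) = p ^ 2 * 1 := by linarith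
  have h6 := Nat.eq_of_mul_eq_mul_left (pow_pos hp.pos 2) h5
  exact Subgroup.index_eq_one.1 (Nat.eq_one_of_mul_eq_one_left h6)

/-- If the center has index `p ^ 2`, every subgroup containing it is normal. -/
theorem Subgroup.normal_of_center_le_of_index_center_eq_prime_sq {G : Type*} [Group G] {p : ℕ}
    (hp : p.Prime) (hZ : (Subgroup.center G).index = p ^ 2) {H : Subgroup G}
    (hH : Subgroup.center G ≤ H) : H.Normal := by
  have : Fact p.Prime := ⟨hp⟩
  have hcomm := IsPGroup.isMulCommutative_of_card_eq_prime_sq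
    (G := G ⧸ Subgroup.center G) (p := p) (by rw [← Subgroup.index_eq_card, hZ])
  refine ⟨fun h hh g => ?_⟩
  have hmem : h⁻¹ * (g * h * g⁻¹) ∈ Subgroup.center G := by
    rw [← QuotientGroup.eq]
    simp only [QuotientGroup.mk_mul, QuotientGroup.mk_inv]
    rw [hcomm.is_comm.comm (g : G ⧸ Subgroup.center G) h, mul_inv_cancel_right]
  simpa using H.mul_mem hh (hH hmem)

/-- If `G` is a group of order `p^n`, `n ≥ 3`, with center of order `p^(n-2)`,
then every class preserving automorphism of `G` is inner. -/
theorem class_preserving_inner_of_center_index_p_sq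
    (p : ℕ) (hp : p.Prime) (n : ℕ) (hn : 3 ≤ n)
    (G : Type*) [Group G] (hG : Nat.card G = p ^ n)
    (hZ : Nat.card (Subgroup.center G) = p ^ (n - 2)) :
    ∀ α : G ≃* G, (∀ x : G, IsConj x (α x)) →
      ∃ g : G, ∀ x : G, α x = g⁻¹ * x * g := by
  intro α hα
  have hidx : (Subgroup.center G).index = p ^ 2 := by
    have h := (Subgroup.center G).card_mul_index
    rw [hZ, hG, show n = n - 2 + 2 by omega, pow_add, Nat.add_sub_cancel] at h
    exact Nat.eq_of_mul_eq_mul_left (pow_pos hp.pos _) h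
  have hfix : ∀ z ∈ Subgroup.center G, α z = z := by
    intro z hz
    obtain ⟨c, hc⟩ := isConj_iff.1 (hα z)
    rw [← hc, Subgroup.mem_center_iff.1 hz c, mul_inv_cancel_right]
  obtain ⟨x, hx⟩ : ∃ x, x ∉ Subgroup.center G := by
    by_contra! h
    rw [(Subgroup.eq_top_iff' _).2 h, Subgroup.index_top] at hidx
    have := hp.one_lt
    nlinarith
  obtain ⟨y, hxy⟩ : ∃ y, y * x ≠ x * y := by
    by_contra! h
    exact hx (Subgroup.mem_center_iff.2 h)
  have hcent (w : G) : Subgroup.center G ≤ Subgroup.centralizer {w} :=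
    Subgroup.center_le_centralizer _
  have hself (w : G) : w ∈ Subgroup.centralizer {w} := by
    simp [Subgroup.mem_centralizer_singleton_iff]
  have hyx : y ∉ Subgroup.centralizer {x} := fun h =>
    hxy (Subgroup.mem_centralizer_singleton_iff.1 h)
  have hxy' : x ∉ Subgroup.centralizer {y} := fun h =>
    hxy (Subgroup.mem_centralizer_singleton_iff.1 h).symm
  have hy : y ∉ Subgroup.center G := fun h => hyx (hcent x h)
  have hsup : Subgroup.centralizer {x} ⊔ Subgroup.centralizer {y} = ⊤ :=
    Subgroup.eq_top_of_lt_of_lt_of_index_eq_prime_sq hp hidx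
      (SetLike.lt_iff_le_and_exists.2 ⟨hcent x, x, hself x, hx⟩)
      (SetLike.lt_iff_le_and_exists.2 ⟨le_sup_left, y, Subgroup.mem_sup_right (hself y), hyx⟩)
  have hnormal : (Subgroup.centralizer {y}).Normal :=
    Subgroup.normal_of_center_le_of_index_center_eq_prime_sq hp hidx (hcent y)
  obtain ⟨c, hc⟩ := isConj_iff.1 (hα x)
  obtain ⟨e, he⟩ := isConj_iff.1 (hα y)
  obtain ⟨d, hd, f, hf, hdf⟩ := Subgroup.mem_sup_of_normal_right.1
    (hsup ▸ Subgroup.mem_top (c⁻¹ * e))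
  have hdx := Subgroup.mem_centralizer_singleton_iff.1 hd
  have hfy := Subgroup.mem_centralizer_singleton_iff.1 hf
  let E : Subgroup G := α.toMonoidHom.eqLocus (MulAut.conj (c * d)).toMonoidHom
  have hE (w : G) : w ∈ E ↔ α w = c * d * w * (c * d)⁻¹ := Iff.rfl
  have hZE : Subgroup.center G ≤ E := fun z hz => by
    rw [hE, hfix z hz, Subgroup.mem_center_iff.1 hz, mul_inv_cancel_right]
  have hxE : x ∈ E := by
    rw [hE, ← hc, mul_assoc c d x, hdx]
    group
  have hyE : y ∈ E := by
    have hcd : e = c * d * f := by rw [mul_assoc, hdf, mul_inv_cancel_left]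
    rw [hE, ← he, hcd, mul_assoc (c * d) f y, hfy]
    group
  have htop : E = ⊤ :=
    Subgroup.eq_top_of_lt_of_lt_of_index_eq_prime_sq (A := E ⊓ Subgroup.centralizer {x}) hp hidx
      (SetLike.lt_iff_le_and_exists.2 ⟨le_inf hZE (hcent x), x,
        Subgroup.mem_inf.2 ⟨hxE, hself x⟩, hx⟩)
      (SetLike.lt_iff_le_and_exists.2 ⟨inf_le_left, y, hyE, fun h => hyx (Subgroup.mem_inf.1 h).2⟩)
  refine ⟨(c * d)⁻¹, fun w => ?_⟩
  rw [inv_inv]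
  exact (hE w).1 (htop ▸ Subgroup.mem_top w)
end

section
/- Let p be a prime and let G be a finite p-group of nilpotency class 2 admitting a minimal generating set {x₁, x₂, …, x_m} (i.e., {x₁,…,x_m} generates G and no proper subset of it generates G) such that for each i with 1 ≤ i ≤ m the subgroup [xᵢ, G] generated by the commutators [xᵢ, g] = xᵢ⁻¹g⁻¹xᵢg for g ∈ G is cyclic. Then every class preserving automorphism of G is inner. -/
/-- In a cyclic group generated by `c` of finite order, an element whose order divides the order
of `a` is a power of `a`. -/
lemma mem_zpowers_of_orderOf_dvd {C : Type*} [Group C] {a b c : C} (hc : IsOfFinOrder c)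
    (ha : a ∈ Subgroup.zpowers c) (hb : b ∈ Subgroup.zpowers c)
    (h : orderOf b ∣ orderOf a) : b ∈ Subgroup.zpowers a := by
  obtain ⟨i, rfl⟩ := (Submonoid.mem_powers_iff _ _).mp (hc.mem_powers_iff_mem_zpowers.mpr ha)
  obtain ⟨j, rfl⟩ := Subgroup.mem_zpowers_iff.mp hb
  have hpos : 0 < orderOf c := hc.orderOf_pos
  have hg : 0 < Nat.gcd (orderOf c) i := Nat.gcd_pos_of_pos_left _ hpos
  have hord : orderOf (c ^ i) * Nat.gcd (orderOf c) i = orderOf c := by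
    rw [hc.orderOf_pow, Nat.div_mul_cancel (Nat.gcd_dvd_left _ _)]
  have hn : 0 < orderOf (c ^ i) := Nat.pos_of_mul_pos_right (hord ▸ hpos)
  have hone : c ^ (j * (orderOf (c ^ i) : ℤ)) = 1 := by
    rw [zpow_mul, zpow_natCast]
    exact orderOf_dvd_iff_pow_eq_one.mp h
  have hdvd : ((Nat.gcd (orderOf c) i : ℕ) : ℤ) ∣ j := by
    have h1 := orderOf_dvd_iff_zpow_eq_one.mpr hone
    rw [← hord] at h1
    push_cast at h1
    rw [mul_comm j] at h1
    exact Int.dvd_of_mul_dvd_mul_left (by positivity) h1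
  obtain ⟨t, rfl⟩ := hdvd
  rw [Nat.gcd_eq_gcd_ab, Subgroup.mem_zpowers_iff]
  refine ⟨Nat.gcdB (orderOf c) i * t, ?_⟩
  rw [add_mul, zpow_add, mul_assoc, zpow_mul c, zpow_natCast, pow_orderOf_eq_one, one_zpow,
    one_mul, mul_assoc, zpow_mul c (i : ℤ), zpow_natCast]

/-- Among two elements of a finite cyclic `p`-group, the one of smaller order is a power of the
other. -/
lemma IsPGroup.mem_zpowers_of_orderOf_le {p : ℕ} [Fact p.Prime] {C : Type*} [Group C]
    (hC : IsPGroup p C) {a b c : C} (ha : a ∈ Subgroup.zpowers c) (hb : b ∈ Subgroup.zpowers c)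
    (h : orderOf b ≤ orderOf a) : b ∈ Subgroup.zpowers a := by
  refine mem_zpowers_of_orderOf_dvd (hC.isOfFinOrder (Fact.out : p.Prime).ne_zero c) ha hb ?_
  obtain ⟨k, hk⟩ := IsPGroup.iff_orderOf.mp hC a
  obtain ⟨l, hl⟩ := IsPGroup.iff_orderOf.mp hC b
  rw [hk, hl] at h ⊢
  exact pow_dvd_pow p ((Nat.pow_le_pow_iff_right (Fact.out : p.Prime).one_lt).mp h)

/-- An alternating pairing is antisymmetric. -/
lemma MonoidHom.pairing_swap_of_self {G C : Type*} [Group G] [CommGroup C] (β : G →* G →* C)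
    (hβ : ∀ x, β x x = 1) (x y : G) : β y x = (β x y)⁻¹ := by
  have h := hβ (x * y)
  simp only [map_mul, MonoidHom.mul_apply, hβ, one_mul, mul_one] at h
  exact eq_inv_of_mul_eq_one_left h

/-- Let `β` be an alternating pairing with values in a `p`-group, and let `s` be a finite set such
that `β v` maps `closure s` into a cyclic group for every `v ∈ s`. Then every homomorphism `f` which
is pointwise on `closure s` of the form `v ↦ β v u` is globally of this form. -/
theorem exists_eq_pairing_of_pointwise {p : ℕ} [Fact p.Prime] {G C : Type*} [Group G]
    [CommGroup C] (hC : IsPGroup p C) (β : G →* G →* C) (hβ : ∀ x, β x x = 1) (f : G →* C)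
    (s : Finset G)
    (hcyc : ∀ v ∈ s, ∃ c, ∀ w ∈ Subgroup.closure (s : Set G), β v w ∈ Subgroup.zpowers c)
    (hf : ∀ v ∈ Subgroup.closure (s : Set G), ∃ u ∈ Subgroup.closure (s : Set G), f v = β v u) :
    ∃ w ∈ Subgroup.closure (s : Set G), ∀ v ∈ Subgroup.closure (s : Set G), f v = β v w := by
  classical
  have hswap := β.pairing_swap_of_self hβ
  induction hn : s.card using Nat.strong_induction_on generalizing s with
  | _ n ih =>
  subst hn
  rcases s.eq_empty_or_nonempty with rfl | hs
  · refine ⟨1, one_mem _, fun v hv => ?_⟩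
    simp only [Finset.coe_empty, Subgroup.closure_empty, Subgroup.mem_bot] at hv
    simp [hv]
  obtain ⟨⟨x, y⟩, hxy, hmax⟩ := (s ×ˢ s).exists_max_image (fun q => orderOf (β q.1 q.2))
    (hs.product hs)
  obtain ⟨hx, hy⟩ := Finset.mem_product.mp hxy
  simp only at hx hy
  have hsub : ∀ {v}, v ∈ s → v ∈ Subgroup.closure (s : Set G) :=
    fun hv => Subgroup.subset_closure hv
  have hcx : ∀ w ∈ Subgroup.closure (s : Set G), β x w ∈ Subgroup.zpowers (β x y) := by
    obtain ⟨c, hc⟩ := hcyc x hx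
    change Subgroup.closure (s : Set G) ≤ (Subgroup.zpowers (β x y)).comap (β x)
    rw [Subgroup.closure_le]
    intro z hz
    exact hC.mem_zpowers_of_orderOf_le (hc y (hsub hy)) (hc z (hsub hz))
      (hmax (x, z) (Finset.mk_mem_product hx hz))
  have hcy : ∀ w ∈ Subgroup.closure (s : Set G), β y w ∈ Subgroup.zpowers (β x y) := by
    obtain ⟨c, hc⟩ := hcyc y hy
    change Subgroup.closure (s : Set G) ≤ (Subgroup.zpowers (β x y)).comap (β y)
    rw [Subgroup.closure_le]
    intro z hz
    have hxc : β x y ∈ Subgroup.zpowers c := by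
      rw [hswap y x]
      exact inv_mem (hc x (hsub hx))
    exact hC.mem_zpowers_of_orderOf_le hxc (hc z (hsub hz))
      (hmax (y, z) (Finset.mk_mem_product hy hz))
  have hproj : ∀ v ∈ s, ∃ k l : ℤ, β x (v * x ^ k * y ^ l) = 1 ∧ β y (v * x ^ k * y ^ l) = 1 := by
    intro v hv
    obtain ⟨m, hm⟩ := Subgroup.mem_zpowers_iff.mp (hcx v (hsub hv))
    obtain ⟨n, hn⟩ := Subgroup.mem_zpowers_iff.mp (hcy v (hsub hv))
    refine ⟨n, -m, ?_, ?_⟩ <;>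
      simp [hβ, hswap x y, ← hm, ← hn]
  choose! k l hk hl using hproj
  set t : Finset G := (s.erase x).image (fun v => v * x ^ k v * y ^ l v) with ht
  have htmem : ∀ v ∈ s, v ≠ x → v * x ^ k v * y ^ l v ∈ t := fun v hv hne =>
    Finset.mem_image_of_mem _ (Finset.mem_erase.mpr ⟨hne, hv⟩)
  have hts : Subgroup.closure (t : Set G) ≤ Subgroup.closure (s : Set G) := by
    rw [Subgroup.closure_le]
    intro z hz
    obtain ⟨v, hv, rfl⟩ := Finset.mem_image.mp (Finset.mem_coe.mp hz)
    exact mul_mem (mul_mem (hsub (Finset.mem_of_mem_erase hv)) (zpow_mem (hsub hx) _))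
      (zpow_mem (hsub hy) _)
  have hperp : Subgroup.closure (t : Set G) ≤ (β x).ker ⊓ (β y).ker := by
    rw [Subgroup.closure_le]
    intro z hz
    obtain ⟨v, hv, rfl⟩ := Finset.mem_image.mp (Finset.mem_coe.mp hz)
    have hvs := Finset.mem_of_mem_erase hv
    exact ⟨hk v hvs, hl v hvs⟩
  have hpx : ∀ w ∈ Subgroup.closure (t : Set G), β x w = 1 := fun w hw => (hperp hw).1
  have hpy : ∀ w ∈ Subgroup.closure (t : Set G), β y w = 1 := fun w hw => (hperp hw).2
  have hrepl : ∀ u ∈ Subgroup.closure (s : Set G), ∃ u' ∈ Subgroup.closure (t : Set G),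
      ∀ v ∈ Subgroup.closure (t : Set G), β v u = β v u' := by
    intro u hu
    induction hu using Subgroup.closure_induction with
    | mem z hz =>
      by_cases hzx : z = x
      · subst hzx
        exact ⟨1, one_mem _, fun v hv => by simp [hswap z v, hpx v hv]⟩
      · refine ⟨_, Subgroup.subset_closure (htmem z hz hzx), fun v hv => ?_⟩
        simp [hswap x v, hswap y v, hpx v hv, hpy v hv]
    | one => exact ⟨1, one_mem _, fun v _ => rfl⟩
    | mul a b _ _ iha ihb =>
      obtain ⟨a', ha', ha⟩ := iha
      obtain ⟨b', hb', hb⟩ := ihb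
      exact ⟨a' * b', mul_mem ha' hb', fun v hv => by rw [map_mul, map_mul, ha v hv, hb v hv]⟩
    | inv a _ iha =>
      obtain ⟨a', ha', ha⟩ := iha
      exact ⟨a'⁻¹, inv_mem ha', fun v hv => by rw [map_inv, map_inv, ha v hv]⟩
  obtain ⟨w, hw, hfw⟩ := ih t.card
    (Finset.card_image_le.trans_lt (Finset.card_erase_lt_of_mem hx)) t
    (by
      intro z hz
      obtain ⟨v, hv, rfl⟩ := Finset.mem_image.mp hz
      obtain ⟨c, hc⟩ := hcyc v (Finset.mem_of_mem_erase hv)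
      refine ⟨c, fun u hu => ?_⟩
      simpa [hpx u hu, hpy u hu] using hc u (hts hu))
    (by
      intro v hv
      obtain ⟨u, hu, hfu⟩ := hf v (hts hv)
      obtain ⟨u', hu', h⟩ := hrepl u hu
      exact ⟨u', hu', hfu.trans (h v hv)⟩) rfl
  obtain ⟨u₁, hu₁, hfx⟩ := hf x (hsub hx)
  obtain ⟨u₂, hu₂, hfy⟩ := hf y (hsub hy)
  obtain ⟨m, hm⟩ := Subgroup.mem_zpowers_iff.mp (hcx u₁ hu₁)
  obtain ⟨n, hn⟩ := Subgroup.mem_zpowers_iff.mp (hcy u₂ hu₂)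
  refine ⟨w * y ^ m * x ^ (-n), mul_mem (mul_mem (hts hw) (zpow_mem (hsub hy) _))
    (zpow_mem (hsub hx) _), ?_⟩
  have hx' : f x = β x (w * y ^ m * x ^ (-n)) := by
    simp [hfx, ← hm, hβ, hpx w hw]
  have hy' : f y = β y (w * y ^ m * x ^ (-n)) := by
    simp [hfy, ← hn, hβ, hpy w hw, hswap x y]
  change Subgroup.closure (s : Set G) ≤ f.eqLocus (β.flip (w * y ^ m * x ^ (-n)))
  rw [Subgroup.closure_le]
  intro v hv
  change f v = β v (w * y ^ m * x ^ (-n))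
  by_cases hvx : v = x
  · rw [hvx, hx']
  have hvt : _ ∈ Subgroup.closure (t : Set G) := Subgroup.subset_closure (htmem v hv hvx)
  have hv' : f (v * x ^ k v * y ^ l v)
      = β (v * x ^ k v * y ^ l v) (w * y ^ m * x ^ (-n)) := by
    rw [hfw _ hvt, map_mul (β _), map_mul (β _), map_zpow, map_zpow, hswap x, hswap y,
      hpx _ hvt, hpy _ hvt]
    simp
  simp only [map_mul f, map_zpow f, map_mul β, map_zpow β, MonoidHom.mul_apply,
    MonoidHom.zpow_apply, ← hx', ← hy'] at hv'
  exact mul_right_cancel (mul_right_cancel hv')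

open scoped IsMulCommutative

/-- The commutator pairing `(x, y) ↦ x⁻¹ * y⁻¹ * x * y` of a group whose commutator subgroup is
central. -/
def centralCommutatorPairing {G : Type*} [Group G] (h : commutator G ≤ Subgroup.center G) :
    G →* G →* Subgroup.center G :=
  have hc (x y : G) : x⁻¹ * y⁻¹ * x * y ∈ Subgroup.center G := h <| by
    simpa [commutatorElement_def, commutator_def] using
      Subgroup.commutator_mem_commutator (Subgroup.mem_top x⁻¹) (Subgroup.mem_top y⁻¹)
  MonoidHom.mk' (fun x => MonoidHom.mk' (fun y => ⟨x⁻¹ * y⁻¹ * x * y, hc x y⟩) fun y z => by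
    ext
    have := Subgroup.mem_center_iff.mp (hc x y) (x⁻¹ * z⁻¹ * x)
    calc x⁻¹ * (y * z)⁻¹ * x * (y * z)
        = x⁻¹ * z⁻¹ * x * (x⁻¹ * y⁻¹ * x * y) * z := by group
      _ = (x⁻¹ * y⁻¹ * x * y) * (x⁻¹ * z⁻¹ * x * z) := by rw [this]; group) fun x y => by
    ext z
    have := Subgroup.mem_center_iff.mp (hc x z) y⁻¹
    calc (x * y)⁻¹ * z⁻¹ * (x * y) * z
        = y⁻¹ * (x⁻¹ * z⁻¹ * x * z) * (z⁻¹ * y * z) := by group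
      _ = (x⁻¹ * z⁻¹ * x * z) * (y⁻¹ * z⁻¹ * y * z) := by rw [this]; group

@[simp]
lemma coe_centralCommutatorPairing {G : Type*} [Group G] (h : commutator G ≤ Subgroup.center G)
    (x y : G) : (centralCommutatorPairing h x y : G) = x⁻¹ * y⁻¹ * x * y := rfl

/-- Let `G` be a finite `p`-group of nilpotency class 2 with a minimal generating set
`{x₁, …, x_m}` such that each `[xᵢ, G]` (the subgroup generated by the commutators
`[xᵢ,g] = xᵢ⁻¹g⁻¹xᵢg`) is cyclic. Then every class preserving automorphism of `G` is
inner. -/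
theorem class_preserving_inner_of_class_two_min_gen_cyclic_commutators
    (p : ℕ) (hp : p.Prime) (G : Type*) [Group G] [Finite G]
    (hpG : IsPGroup p G)
    (hclass : commutator G ≠ ⊥ ∧ commutator G ≤ Subgroup.center G)
    (S : Finset G)
    (hgen : Subgroup.closure (S : Set G) = ⊤)
    (hmin : ∀ T : Finset G, T ⊂ S → Subgroup.closure (T : Set G) ≠ ⊤)
    (hcyc : ∀ x ∈ S,
      IsCyclic (Subgroup.closure {c : G | ∃ g : G, c = x⁻¹ * g⁻¹ * x * g})) :
    ∀ α : G ≃* G, (∀ x : G, IsConj x (α x)) →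
      ∃ g : G, ∀ x : G, α x = g⁻¹ * x * g := by
  intro α hα
  have := Fact.mk hp
  let β := centralCommutatorPairing hclass.2
  have hconj (x : G) : ∃ u, x⁻¹ * α x = (β x u : G) := by
    obtain ⟨c, hc⟩ := isConj_iff.mp (hα x)
    exact ⟨c⁻¹, by simp only [β, coe_centralCommutatorPairing, ← hc, inv_inv, mul_assoc]⟩
  have hcent (x : G) : x⁻¹ * α x ∈ Subgroup.center G := by
    obtain ⟨u, hu⟩ := hconj x
    exact hu ▸ (β x u).2
  let f : G →* Subgroup.center G := MonoidHom.mk' (fun x => ⟨x⁻¹ * α x, hcent x⟩) fun x y => by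
    ext
    have := Subgroup.mem_center_iff.mp (hcent x) y⁻¹
    calc (x * y)⁻¹ * α (x * y) = y⁻¹ * (x⁻¹ * α x) * α y := by rw [map_mul]; group
      _ = (x⁻¹ * α x) * (y⁻¹ * α y) := by rw [this, mul_assoc]
  have hβ (x : G) : β x x = 1 := by
    ext
    simp [β]
  obtain ⟨g, -, hg⟩ := exists_eq_pairing_of_pointwise (hpG.to_subgroup (Subgroup.center G)) β hβ f S
    (by
      intro v hv
      have hcv := hcyc v hv
      have hle : Subgroup.closure {c : G | ∃ g : G, c = v⁻¹ * g⁻¹ * v * g} ≤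
          Subgroup.center G := by
        rw [Subgroup.closure_le]
        rintro _ ⟨g, rfl⟩
        exact (β v g).2
      obtain ⟨c, hc⟩ := hcv.exists_generator
      refine ⟨⟨c, hle c.2⟩, fun w _ => ?_⟩
      obtain ⟨n, hn⟩ := Subgroup.mem_zpowers_iff.mp
        (hc ⟨v⁻¹ * w⁻¹ * v * w, Subgroup.subset_closure ⟨w, rfl⟩⟩)
      exact Subgroup.mem_zpowers_iff.mpr ⟨n, by
        ext
        simpa [β] using congrArg Subtype.val hn⟩)
    (by
      intro v _
      obtain ⟨u, hu⟩ := hconj v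
      exact ⟨u, by simp [hgen], Subtype.ext hu⟩)
  refine ⟨g, fun x => ?_⟩
  have h : x⁻¹ * α x = x⁻¹ * g⁻¹ * x * g := congrArg Subtype.val (hg x (by simp [hgen]))
  rw [inv_mul_eq_iff_eq_mul.mp h]
  group
end

section
/- Let G be a finite group generated by two elements x and y such that every element of G can be written in the form xⁱyʲ for some integers i and j. Then every class preserving automorphism of G is inner. -/
/-- Let `G` be a finite group generated by two elements `x, y` such that every element of
`G` can be written in the form `x^i * y^j`. Then every class preserving automorphism of
`G` is inner. -/
theorem class_preserving_inner_of_two_gen_product_form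
    (G : Type*) [Group G] [Finite G] (x y : G)
    (hgen : Subgroup.closure ({x, y} : Set G) = ⊤)
    (h : ∀ g : G, ∃ i j : ℤ, g = x ^ i * y ^ j) :
    ∀ α : G ≃* G, (∀ z : G, IsConj z (α z)) →
      ∃ g : G, ∀ z : G, α z = g⁻¹ * z * g := by
  intro α hα
  obtain ⟨b, hb⟩ := isConj_iff.mp (hα x)
  obtain ⟨c, hc⟩ := isConj_iff.mp (hα y)
  obtain ⟨i, j, hij⟩ := h (b⁻¹ * c)
  have hc' : c = b * x ^ i * y ^ j := by
    rw [mul_assoc, ← hij, mul_inv_cancel_left]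
  have hx : α x = MulAut.conj (b * x ^ i) x := by
    rw [← hb, MulAut.conj_apply]
    group
  have hy : α y = MulAut.conj (b * x ^ i) y := by
    rw [← hc, hc', MulAut.conj_apply]
    group
  refine ⟨(b * x ^ i)⁻¹, fun z => ?_⟩
  obtain ⟨m, n, rfl⟩ := h z
  rw [inv_inv, ← MulAut.conj_apply, map_mul, map_mul, map_zpow, map_zpow, map_zpow, map_zpow,
    hx, hy]
end

section
/- Let H and K be finite groups and let G = H × K be their direct product. Then every class preserving automorphism of G is inner if and only if every class preserving automorphism of H is inner and every class preserving automorphism of K is inner. -/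
/-- Every class preserving automorphism of `G` is inner. -/
def AllClassPreservingInner (G : Type*) [Group G] : Prop :=
  ∀ α : G ≃* G, (∀ x : G, IsConj x (α x)) → ∃ g : G, ∀ x : G, α x = g⁻¹ * x * g

theorem isConj_prod_iff {H K : Type*} [Group H] [Group K] {x y : H × K} :
    IsConj x y ↔ IsConj x.1 y.1 ∧ IsConj x.2 y.2 := by
  simp only [isConj_iff, Prod.ext_iff, Prod.exists, Prod.fst_mul, Prod.snd_mul, Prod.fst_inv,
    Prod.snd_inv, exists_and_left, exists_and_right]

theorem AllClassPreservingInner.congr {G G' : Type*} [Group G] [Group G']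
    (hG : AllClassPreservingInner G) (e : G ≃* G') : AllClassPreservingInner G' := by
  intro α hα
  obtain ⟨g, hg⟩ := hG ((e.trans α).trans e.symm) fun x => by
    simpa using e.symm.toMonoidHom.map_isConj (hα (e x))
  refine ⟨e g, fun x => ?_⟩
  have := congrArg e (hg (e.symm x))
  simpa using this

theorem AllClassPreservingInner.fst_of_prod {H K : Type*} [Group H] [Group K]
    (hG : AllClassPreservingInner (H × K)) : AllClassPreservingInner H := by
  intro α hα
  obtain ⟨g, hg⟩ := hG (α.prodCongr (MulEquiv.refl K)) fun x =>
    isConj_prod_iff.2 ⟨hα x.1, IsConj.refl x.2⟩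
  exact ⟨g.1, fun x => congrArg Prod.fst (hg (x, 1))⟩

/-- In a finite group, class preserving endomorphisms are automatically injective, hence
automorphisms. -/
theorem AllClassPreservingInner.exists_conj_of_monoidHom {G : Type*} [Group G] [Finite G]
    (hG : AllClassPreservingInner G) (f : G →* G) (hf : ∀ x, IsConj x (f x)) :
    ∃ g : G, ∀ x, f x = g⁻¹ * x * g := by
  have hinj : Function.Injective f := (injective_iff_map_eq_one f).2 fun x hx => by
    have h := hf x
    rwa [hx, isConj_one_left] at h
  exact hG (MulEquiv.ofBijective f (Finite.injective_iff_bijective.1 hinj)) hf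

theorem AllClassPreservingInner.prod {H K : Type*} [Group H] [Group K] [Finite H] [Finite K]
    (hH : AllClassPreservingInner H) (hK : AllClassPreservingInner K) :
    AllClassPreservingInner (H × K) := by
  intro α hα
  have hconj x := isConj_prod_iff.1 (hα x)
  obtain ⟨a, ha⟩ := hH.exists_conj_of_monoidHom
    ((MonoidHom.fst H K).comp (α.toMonoidHom.comp (MonoidHom.inl H K)))
    fun x => (hconj (x, 1)).1
  obtain ⟨b, hb⟩ := hK.exists_conj_of_monoidHom
    ((MonoidHom.snd H K).comp (α.toMonoidHom.comp (MonoidHom.inr H K)))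
    fun x => (hconj (1, x)).2
  have hl (x : H) : (α (x, 1)).2 = 1 := isConj_one_right.1 (hconj (x, 1)).2
  have hr (y : K) : (α (1, y)).1 = 1 := isConj_one_right.1 (hconj (1, y)).1
  refine ⟨(a, b), fun ⟨x, y⟩ => ?_⟩
  have hxy : α (x, y) = α (x, 1) * α (1, y) := by simp [← map_mul]
  rw [hxy]
  refine Prod.ext ?_ ?_
  · simpa [hr] using ha x
  · simpa [hl] using hb y

/-- For finite groups `H` and `K`, every class preserving automorphism of `H × K` is
inner if and only if the same holds for `H` and for `K`. -/
theorem allClassPreservingInner_prod_iff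
    (H K : Type*) [Group H] [Group K] [Finite H] [Finite K] :
    AllClassPreservingInner (H × K) ↔
      AllClassPreservingInner H ∧ AllClassPreservingInner K := by
  exact ⟨fun hG => ⟨hG.fst_of_prod, (hG.congr MulEquiv.prodComm).fst_of_prod⟩,
    fun ⟨hH, hK⟩ => hH.prod hK⟩
end

section
/- Let G be a finite group having an abelian normal subgroup A such that the quotient group G/A is cyclic. Then every class preserving automorphism of G is inner. -/
section LocallyPower

variable {R M : Type*} [CommRing R] [AddCommGroup M] [Module R M]

lemma pow_smul_eq_self {r : R} {m : M} (h : r • m = m) (k : ℕ) : r ^ k • m = m := by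
  induction k with
  | zero => simp
  | succ k ih => rw [pow_succ, mul_smul, h, ih]

lemma pow_smul_eq_pow_smul {f x : R} {m : M} (h : f • m = x • m) (k : ℕ) :
    f ^ k • m = x ^ k • m := by
  induction k with
  | zero => simp
  | succ k ih => rw [pow_succ, pow_succ, mul_smul, mul_smul, h, smul_comm, ih, smul_comm]

/-- If `(v - 1) • m = (v ^ l - 1) • n`, then `v` fixes `m - (1 + v + ⋯ + v ^ (l - 1)) • n`. -/
lemma smul_sub_geom_sum_smul {v : R} {m n : M} {l : ℕ}
    (h : v • m + n = m + v ^ l • n) :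
    v • (m - (∑ i ∈ Finset.range l, v ^ i) • n) = m - (∑ i ∈ Finset.range l, v ^ i) • n := by
  have hN := mul_geom_sum v l
  have h1 : v • m - m = (v ^ l - 1) • n := by
    rw [sub_smul, one_smul, sub_eq_sub_iff_add_eq_add, h, add_comm]
  rw [← sub_eq_zero]
  have : v • (m - (∑ i ∈ Finset.range l, v ^ i) • n) - (m - (∑ i ∈ Finset.range l, v ^ i) • n)
      = (v • m - m) - ((v - 1) * ∑ i ∈ Finset.range l, v ^ i) • n := by module
  rw [this, hN, h1, sub_self]

/-- In a cyclic group of order dividing `q ^ e`, every element `x ^ k` generates the same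
subgroup as some `x ^ (q ^ b)`. -/
lemma exists_prime_pow_generator {N : Type*} [Monoid N] {x : N} {q e : ℕ} (hq : q.Prime)
    (hx : x ^ q ^ e = 1) (k : ℕ) :
    ∃ b ≤ e, (∃ l, x ^ q ^ b = (x ^ k) ^ l) ∧ ∃ l, x ^ k = (x ^ q ^ b) ^ l := by
  obtain ⟨b, hb, hgcd⟩ := (Nat.dvd_prime_pow hq).1 (Nat.gcd_dvd_right k (q ^ e))
  refine ⟨b, hb, ?_, ?_⟩
  · rcases hb.eq_or_lt with rfl | hlt
    · exact ⟨0, by rw [hx, pow_zero]⟩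
    · obtain ⟨l, -, hl⟩ := Nat.exists_mul_mod_eq_gcd
        (hgcd ▸ Nat.pow_lt_pow_right hq.one_lt hlt : Nat.gcd k (q ^ e) < q ^ e)
      exact ⟨l, by rw [← pow_mul, pow_eq_pow_mod _ hx, pow_eq_pow_mod (k * l) hx, hl, hgcd,
        Nat.mod_eq_of_lt (Nat.pow_lt_pow_right hq.one_lt hlt)]⟩
  · obtain ⟨l, hl⟩ := hgcd ▸ Nat.gcd_dvd_left k (q ^ e)
    exact ⟨l, by rw [← pow_mul, ← hl]⟩

variable [FaithfulSMul R M]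

lemma eq_one_of_locally_power_of_pow_prime_eq_one {q d : ℕ} (hq : q.Prime) {x g : R}
    (hord : orderOf x = q ^ (d + 1)) (hg : ∀ m : M, ∃ i : ℕ, g • m = x ^ i • m)
    {m₁ : M} (hz : x ^ q ^ d • m₁ ≠ m₁) (hm₁ : g • m₁ = m₁) (hgq : g ^ q = 1) : g = 1 := by
  have hx : x ^ q ^ (d + 1) = 1 := hord ▸ pow_orderOf_eq_one x
  set z := x ^ q ^ d with hzdef
  have hzq : z ^ q = 1 := by rw [hzdef, ← pow_mul, ← pow_succ, hx]
  have hpow : ∀ k, x ^ k = 1 ∨ ∃ l, z = (x ^ k) ^ l := fun k => by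
    obtain ⟨b, hb, ⟨l, hl⟩, l', hl'⟩ := exists_prime_pow_generator hq hx k
    rcases hb.eq_or_lt with rfl | hb
    · left; rw [hl', hx, one_pow]
    · right
      refine ⟨l * q ^ (d - b), ?_⟩
      rw [pow_mul, ← hl, ← pow_mul, ← pow_add, Nat.add_sub_cancel' (by omega)]
  have hreg : ∀ m : M, z • m ≠ m → ∃ i : ℕ, g • m = z ^ i • m := fun m hm => by
    obtain ⟨i, hi⟩ := hg m
    have h1 := pow_smul_eq_pow_smul hi q
    rw [hgq, one_smul, ← pow_mul] at h1
    rcases hpow (i * q) with h | ⟨l, hl⟩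
    · have := orderOf_dvd_of_pow_eq_one h
      rw [hord, pow_succ] at this
      obtain ⟨k, rfl⟩ := Nat.dvd_of_mul_dvd_mul_right hq.pos this
      exact ⟨k, by rw [hi, hzdef, ← pow_mul]⟩
    · exact absurd (hl ▸ pow_smul_eq_self h1.symm l) hm
  have hgN : ∀ r : R, g • r • m₁ = r • m₁ := fun r => by rw [smul_comm, hm₁]
  have hfix' : ∀ a : ℕ, ∀ m : M, z • m = m → x ^ q ^ a • m = m → g • m = m := by
    intro a
    induction a with
    | zero =>
      intro m _ h
      obtain ⟨i, hi⟩ := hg m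
      rw [hi]
      exact pow_smul_eq_self (by simpa using h) i
    | succ a ih =>
      intro m hzm hxm
      obtain ⟨k, hk⟩ := hg m
      obtain ⟨b, hb, ⟨l, hl⟩, l', hl'⟩ := exists_prime_pow_generator hq hx k
      rcases le_or_gt (a + 1) b with hab | hab
      · obtain ⟨t, rfl⟩ := Nat.exists_eq_add_of_le hab
        rw [hk, hl', pow_add, pow_mul]
        exact pow_smul_eq_self (pow_smul_eq_self hxm _) _
      rcases hpow k with h1 | ⟨s, hs⟩
      · rw [hk, h1, one_smul]
      obtain ⟨i, hi⟩ := hreg (m + m₁) (by rwa [smul_add, hzm, ne_eq, add_right_inj])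
      rw [smul_add, smul_add, hm₁, pow_smul_eq_self hzm, hk, hs, ← pow_mul] at hi
      have hv := smul_sub_geom_sum_smul hi
      set r := ∑ i ∈ Finset.range (s * i), (x ^ k) ^ i
      have := ih (m - r • m₁) (by rw [hs]; exact pow_smul_eq_self hv s) (by
        have : x ^ q ^ a = (x ^ k) ^ (l * q ^ (a - b)) := by
          rw [pow_mul, ← hl, ← pow_mul, ← pow_add, Nat.add_sub_cancel' (by omega)]
        rw [this]
        exact pow_smul_eq_self hv _)
      rwa [smul_sub, hgN, sub_left_inj] at this
  have hfix : ∀ m : M, z • m = m → g • m = m := fun m h =>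
    hfix' (d + 1) m h (by rw [hx, one_smul])
  refine FaithfulSMul.eq_of_smul_eq_smul (α := M) fun m => ?_
  rw [one_smul]
  by_cases hm : z • m = m
  · exact hfix m hm
  by_cases hmm : z • (m + m₁) = m + m₁
  · have := hfix _ hmm
    rwa [smul_add, hm₁, add_left_inj] at this
  obtain ⟨i, hi⟩ := hreg m hm
  obtain ⟨j, hj⟩ := hreg _ hmm
  have hjj : z ^ j * z ^ (j * (q - 1)) = 1 := by
    rw [← pow_add, show j + j * (q - 1) = q * j by
      obtain ⟨p, hp⟩ := Nat.exists_eq_add_of_le hq.one_le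
      rw [hp, Nat.add_sub_cancel_left]; ring, pow_mul, hzq, one_pow]
  set w := z ^ (i + j * (q - 1)) with hw
  have hwi : z ^ i = w * z ^ j := by
    rw [hw, pow_add, mul_assoc, mul_comm _ (z ^ j), hjj, mul_one]
  have hwx : w = x ^ (q ^ d * (i + j * (q - 1))) := by rw [hw, hzdef, ← pow_mul]
  rw [smul_add, smul_add, hm₁, hi, hwi, mul_smul] at hj
  rcases hpow (q ^ d * (i + j * (q - 1))) with h1 | ⟨s, hs⟩
  · rw [← hwx] at h1
    rw [h1, one_smul, add_right_inj] at hj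
    rcases hpow (q ^ d * j) with h2 | ⟨t, ht⟩
    · rw [hi, hwi, h1, hzdef, ← pow_mul, h2, one_mul, one_smul]
    · rw [pow_mul, ← hzdef] at ht
      refine absurd ?_ hz
      rw [ht]
      exact pow_smul_eq_self hj.symm t
  · rw [← hwx] at hs
    have hzj : z ^ j = w ^ (s * j) := by rw [pow_mul, ← hs]
    have hv := smul_sub_geom_sum_smul (m := z ^ j • m) (n := m₁) (v := w) (l := s * j)
      (by rw [← hzj]; exact hj)
    have := hfix _ (by rw [hs]; exact pow_smul_eq_self hv s)
    rw [smul_sub, hgN, sub_left_inj, smul_comm] at this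
    have := congrArg (z ^ (j * (q - 1)) • ·) this
    simpa only [smul_smul, mul_comm _ (z ^ j), hjj, one_smul, ← mul_assoc, one_mul] using this

lemma eq_one_of_locally_power_of_prime_pow {q d : ℕ} (hq : q.Prime) {x : R}
    (hord : orderOf x = q ^ (d + 1)) {m₁ : M} (hz : x ^ q ^ d • m₁ ≠ m₁) (e : ℕ) {g : R}
    (hg : ∀ m : M, ∃ i : ℕ, g • m = x ^ i • m) (hm₁ : g • m₁ = m₁) (hgq : g ^ q ^ e = 1) :
    g = 1 := by
  induction e generalizing g with
  | zero => simpa using hgq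
  | succ e ih =>
    refine eq_one_of_locally_power_of_pow_prime_eq_one hq hord hg hz hm₁
      (ih (fun m => ?_) (pow_smul_eq_self hm₁ q) (by rw [← pow_mul, ← pow_succ', hgq]))
    obtain ⟨i, hi⟩ := hg m
    exact ⟨i * q, by rw [pow_mul]; exact pow_smul_eq_pow_smul hi q⟩

lemma pow_eq_one_of_locally_power {n : ℕ} {x f : R} (hx : x ^ n = 1)
    (hf : ∀ m : M, ∃ i : ℕ, f • m = x ^ i • m) : f ^ n = 1 := by
  refine FaithfulSMul.eq_of_smul_eq_smul (α := M) fun m => ?_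
  obtain ⟨i, hi⟩ := hf m
  rw [pow_smul_eq_pow_smul hi, ← pow_mul, mul_comm, pow_mul, hx, one_pow]

lemma exists_eq_pow_of_locally_power_of_prime_pow {q e : ℕ} (hq : q.Prime) {x f : R}
    (hx : x ^ q ^ e = 1) (hf : ∀ m : M, ∃ i : ℕ, f • m = x ^ i • m) : ∃ i : ℕ, f = x ^ i := by
  obtain ⟨c, -, hc⟩ := (Nat.dvd_prime_pow hq).1 (orderOf_dvd_of_pow_eq_one hx)
  rcases c with _ | d
  · have h1 : x = 1 := orderOf_eq_one_iff.1 (by simpa using hc)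
    refine ⟨0, FaithfulSMul.eq_of_smul_eq_smul (α := M) fun m => ?_⟩
    obtain ⟨i, hi⟩ := hf m
    rw [hi, h1, one_pow, one_pow]
  obtain ⟨m₁, hm₁⟩ : ∃ m₁ : M, x ^ q ^ d • m₁ ≠ m₁ := by
    by_contra! h
    have : x ^ q ^ d = 1 :=
      FaithfulSMul.eq_of_smul_eq_smul (α := M) fun m => by rw [h, one_smul]
    have := (Nat.pow_dvd_pow_iff_le_right hq.one_lt).1 (hc ▸ orderOf_dvd_of_pow_eq_one this)
    omega
  obtain ⟨i, hi⟩ := hf m₁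
  have hinv : x ^ (i * (q ^ e - 1)) * x ^ i = 1 := by
    rw [← pow_add, show i * (q ^ e - 1) + i = q ^ e * i by
      obtain ⟨p, hp⟩ := Nat.exists_eq_add_of_le (Nat.one_le_pow e q hq.pos)
      rw [hp, Nat.add_sub_cancel_left]; ring, pow_mul, hx, one_pow]
  have hg : ∀ m : M, ∃ j : ℕ, (x ^ (i * (q ^ e - 1)) * f) • m = x ^ j • m := fun m => by
    obtain ⟨j, hj⟩ := hf m
    exact ⟨i * (q ^ e - 1) + j, by rw [mul_smul, hj, ← mul_smul, ← pow_add]⟩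
  have := eq_one_of_locally_power_of_prime_pow hq hc hm₁ e hg
    (by rw [mul_smul, hi, ← mul_smul, hinv, one_smul]) (pow_eq_one_of_locally_power hx hg)
  refine ⟨i, ?_⟩
  calc f = (x ^ (i * (q ^ e - 1)) * x ^ i) * f := by rw [hinv, one_mul]
    _ = x ^ i * (x ^ (i * (q ^ e - 1)) * f) := by ring
    _ = x ^ i := by rw [this, mul_one]

/-- If `x` has finite multiplicative order and `f` agrees with some power of `x` at every point of
a faithful module, then `f` is a power of `x`. -/
theorem exists_eq_pow_of_locally_power {n : ℕ} (hn : 0 < n) {x f : R} (hx : x ^ n = 1)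
    (hf : ∀ m : M, ∃ i : ℕ, f • m = x ^ i • m) : ∃ i : ℕ, f = x ^ i := by
  induction n using Nat.recOnPosPrimePosCoprime generalizing x f with
  | prime_pow p k hp _ => exact exists_eq_pow_of_locally_power_of_prime_pow hp hx hf
  | zero => exact absurd hn (lt_irrefl 0)
  | one =>
    exact exists_eq_pow_of_locally_power_of_prime_pow (M := M) Nat.prime_two (e := 0)
      (by simpa using hx) hf
  | coprime a b ha hb hab iha ihb =>
    have hfn := pow_eq_one_of_locally_power hx hf
    have hpow : ∀ c : ℕ, ∀ m : M, ∃ i : ℕ, f ^ c • m = (x ^ c) ^ i • m := fun c m => by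
      obtain ⟨i, hi⟩ := hf m
      exact ⟨i, by rw [pow_smul_eq_pow_smul hi, pow_right_comm]⟩
    obtain ⟨i, hi⟩ := iha (by omega) (x := x ^ b) (f := f ^ b)
      (by rw [← pow_mul, mul_comm, hx]) (hpow b)
    obtain ⟨j, hj⟩ := ihb (by omega) (x := x ^ a) (f := f ^ a)
      (by rw [← pow_mul, hx]) (hpow a)
    obtain ⟨u, hu⟩ := Nat.chineseRemainder hab 1 0
    obtain ⟨t, ht⟩ := Nat.modEq_zero_iff_dvd.1 hu.2
    obtain ⟨u', hu'⟩ := Nat.chineseRemainder hab 0 1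
    obtain ⟨t', ht'⟩ := Nat.modEq_zero_iff_dvd.1 hu'.1
    have key : 1 ≡ b * t + a * t' [MOD a * b] := by
      rw [← ht, ← ht']
      exact ((Nat.modEq_and_modEq_iff_modEq_mul hab).1
        ⟨by simpa using hu.1.add hu'.1, by simpa using hu.2.add hu'.2⟩).symm
    refine ⟨b * i * t + a * j * t', ?_⟩
    have h1 : f ^ 1 = f ^ (b * t + a * t') := by
      rw [pow_eq_pow_mod 1 hfn, key, ← pow_eq_pow_mod _ hfn]
    rw [pow_one, pow_add, pow_mul, pow_mul, hi, hj] at h1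
    rw [h1, pow_add, pow_mul, pow_mul, pow_mul, pow_mul]

end LocallyPower

/-- Let `x` be an automorphism of finite order of an abelian group. An endomorphism that commutes
with `x` and agrees with some power of `x` at every point is itself a power of `x`. -/
theorem AddMonoid.End.exists_eq_pow_of_locally_power {M : Type*} [AddCommGroup M]
    {x f : AddMonoid.End M} {n : ℕ} (hn : 0 < n) (hx : x ^ n = 1) (hc : Commute x f)
    (hf : ∀ m : M, ∃ i : ℕ, f m = (x ^ i) m) : ∃ i : ℕ, f = x ^ i := by
  have hcomm : ∀ a ∈ ({x, f} : Set (AddMonoid.End M)), ∀ b ∈ ({x, f} : Set (AddMonoid.End M)),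
      a * b = b * a := by
    rintro a (rfl | rfl) b (rfl | rfl)
    exacts [rfl, hc, hc.symm, rfl]
  have := Subring.isMulCommutative_closure hcomm
  let _ : CommRing (Subring.closure ({x, f} : Set (AddMonoid.End M))) :=
    { (inferInstance : Ring _) with mul_comm := mul_comm' }
  let X : Subring.closure ({x, f} : Set (AddMonoid.End M)) :=
    ⟨x, Subring.subset_closure (by simp)⟩
  let F : Subring.closure ({x, f} : Set (AddMonoid.End M)) :=
    ⟨f, Subring.subset_closure (by simp)⟩
  obtain ⟨i, hi⟩ := _root_.exists_eq_pow_of_locally_power (M := M) hn (x := X) (f := F)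
    (Subtype.ext hx) hf
  exact ⟨i, congrArg Subtype.val hi⟩

/-- Let `G` be a finite group having an abelian normal subgroup `A` with cyclic quotient
`G ⧸ A`. Then every class preserving automorphism of `G` is inner. -/
theorem class_preserving_inner_of_abelian_normal_cyclic_quotient
    (G : Type*) [Group G] [Finite G] (A : Subgroup G) [A.Normal]
    (habelian : ∀ a b : A, a * b = b * a)
    (hcyc : IsCyclic (G ⧸ A)) :
    ∀ α : G ≃* G, (∀ x : G, IsConj x (α x)) →
      ∃ g : G, ∀ x : G, α x = g⁻¹ * x * g := by
  intro α hα
  obtain ⟨y, hy⟩ := hcyc.exists_monoid_generator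
  obtain ⟨x, rfl⟩ := QuotientGroup.mk_surjective y
  have hdecomp : ∀ g : G, ∃ i : ℕ, ∃ a ∈ A, g = x ^ i * a := fun g => by
    obtain ⟨i, hi⟩ := hy g
    exact ⟨i, (x ^ i)⁻¹ * g, QuotientGroup.eq.1 (by simpa using hi), by group⟩
  obtain ⟨c, hc⟩ := isConj_iff.1 (hα x)
  let β : G ≃* G := α.trans (MulAut.conj c⁻¹)
  have hβ : ∀ g, β g = c⁻¹ * α g * c := fun g => by simp [β]
  have hβx : β x = x := by rw [hβ, ← hc]; group
  have hloc : ∀ a ∈ A, ∃ i : ℕ, β a = x ^ i * a * (x ^ i)⁻¹ := fun a ha => by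
    obtain ⟨h, hh⟩ := isConj_iff.1 (hα a)
    obtain ⟨i, b, hb, hib⟩ := hdecomp (c⁻¹ * h)
    refine ⟨i, ?_⟩
    have hab : b * a * b⁻¹ = a := by
      rw [mul_inv_eq_iff_eq_mul]
      exact congrArg Subtype.val (habelian ⟨b, hb⟩ ⟨a, ha⟩)
    calc β a = (c⁻¹ * h) * a * (c⁻¹ * h)⁻¹ := by rw [hβ, ← hh]; group
      _ = x ^ i * (b * a * b⁻¹) * (x ^ i)⁻¹ := by rw [hib]; group
      _ = _ := by rw [hab]
  let _ : CommGroup A := { (inferInstance : Group A) with mul_comm := habelian }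
  have hβA : ∀ a ∈ A, β a ∈ A := fun a ha => by
    obtain ⟨i, hi⟩ := hloc a ha
    rw [hi]
    exact Subgroup.Normal.conj_mem ‹_› a ha _
  let X : AddMonoid.End (Additive A) := MonoidHom.toAdditive (MulAut.conjNormal x).toMonoidHom
  let F : AddMonoid.End (Additive A) := MonoidHom.toAdditive
    ((β.toMonoidHom.comp A.subtype).codRestrict A fun a => hβA a a.2)
  have hX : ∀ (i : ℕ) (a : A),
      (((X ^ i) (Additive.ofMul a)).toMul : G) = x ^ i * a * (x ^ i)⁻¹ := by
    intro i
    induction i with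
    | zero => intro a; simp
    | succ i ih =>
      intro a
      have : (X ^ (i + 1)) (Additive.ofMul a)
          = (X ^ i) (Additive.ofMul (MulAut.conjNormal x a)) := by
        rw [pow_succ]; rfl
      rw [this, ih, MulAut.conjNormal_apply, pow_succ]
      group
  have hext : ∀ {S T : AddMonoid.End (Additive A)},
      (∀ a : A, ((S (Additive.ofMul a)).toMul : G) = (T (Additive.ofMul a)).toMul) → S = T :=
    fun h => AddMonoidHom.ext fun a => Subtype.ext (h a.toMul)
  obtain ⟨i, hi⟩ := AddMonoid.End.exists_eq_pow_of_locally_power (x := X) (f := F)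
    (orderOf_pos x)
    (hext fun a => by rw [hX, pow_orderOf_eq_one]; simp)
    (hext fun a => by
      change x * β a * x⁻¹ = β (x * a * x⁻¹)
      rw [map_mul, map_mul, map_inv, hβx])
    (fun a => by
      obtain ⟨i, hi⟩ := hloc a.toMul a.toMul.2
      exact ⟨i, Subtype.ext (hi.trans (hX i a.toMul).symm)⟩)
  have hβi : ∀ a ∈ A, β a = x ^ i * a * (x ^ i)⁻¹ := fun a ha => by
    rw [← hX i ⟨a, ha⟩, ← hi]
    rfl
  refine ⟨(c * x ^ i)⁻¹, fun g => ?_⟩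
  obtain ⟨k, a, ha, rfl⟩ := hdecomp g
  have h1 : β (x ^ k * a) = x ^ i * (x ^ k * a) * (x ^ i)⁻¹ := by
    rw [map_mul, map_pow, hβx, hβi a ha]
    group
  calc α (x ^ k * a) = c * β (x ^ k * a) * c⁻¹ := by rw [hβ]; group
    _ = _ := by rw [h1]; group
end

section
/- Let p be a prime and let G be a finite p-group such that Z(G) ⊆ [x,G] for every x ∈ G with x ∉ γ₂(G), where γ₂(G) is the commutator subgroup of G. Then the number of class preserving automorphisms of G is at least |Cent(G)| · |G / Z₂(G)|, where Cent(G) is the group of central automorphisms of G and Z₂(G) is the second center of G. -/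
open scoped commutatorElement in
/-- A central automorphism fixes the commutator subgroup pointwise. -/
theorem MulEquiv.apply_eq_self_of_mem_commutator {G : Type*} [Group G] (α : G ≃* G)
    (hα : ∀ x : G, x⁻¹ * α x ∈ Subgroup.center G) {x : G} (hx : x ∈ commutator G) :
    α x = x := by
  have hle : commutator G ≤ α.toMonoidHom.eqLocus (MonoidHom.id G) := by
    rw [commutator_def, Subgroup.commutator_le]
    intro a _ b _
    change α ⁅a, b⁆ = ⁅a, b⁆
    have ha : α a = a * (a⁻¹ * α a) := by group
    have hb : α b = b * (b⁻¹ * α b) := by group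
    have hza := Subgroup.mem_center_iff.1 (hα a)
    have hzb := Subgroup.mem_center_iff.1 (hα b)
    generalize a⁻¹ * α a = z at ha hza
    generalize b⁻¹ * α b = w at hb hzb
    rw [map_commutatorElement, ha, hb, commutatorElement_def, commutatorElement_def]
    calc a * z * (b * w) * (a * z)⁻¹ * (b * w)⁻¹
        = a * (z * (b * w)) * z⁻¹ * a⁻¹ * w⁻¹ * b⁻¹ := by group
      _ = a * b * (w * a⁻¹) * w⁻¹ * b⁻¹ := by rw [← hza]; group
      _ = a * b * a⁻¹ * b⁻¹ := by rw [← hzb]; group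
  exact hle hx

/-- If `Z(G) ⊆ [x,G]` for every `x` outside the commutator subgroup, then every central
automorphism of `G` is class preserving. -/
theorem MulEquiv.isConj_apply_of_central {G : Type*} [Group G]
    (hZ : ∀ x : G, x ∉ commutator G →
      ∀ z ∈ Subgroup.center G, ∃ g : G, z = x⁻¹ * g⁻¹ * x * g)
    (α : G ≃* G) (hα : ∀ x : G, x⁻¹ * α x ∈ Subgroup.center G) (x : G) :
    IsConj x (α x) := by
  by_cases hx : x ∈ commutator G
  · rw [α.apply_eq_self_of_mem_commutator hα hx]
  · obtain ⟨g, hg⟩ := hZ x hx _ (hα x)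
    refine isConj_iff.2 ⟨g⁻¹, ?_⟩
    rw [inv_mul_eq_iff_eq_mul.1 hg]
    group

/-- If two inner automorphisms become equal after composition with central automorphisms, then
the conjugating elements agree modulo the second center. -/
theorem inv_mul_mem_upperCentralSeries_two {G : Type*} [Group G] {α β : G ≃* G}
    (hα : ∀ x : G, x⁻¹ * α x ∈ Subgroup.center G)
    (hβ : ∀ x : G, x⁻¹ * β x ∈ Subgroup.center G) {g h : G}
    (heq : ∀ x : G, α (g * x * g⁻¹) = β (h * x * h⁻¹)) :
    h⁻¹ * g ∈ Subgroup.upperCentralSeries G 2 := by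
  change _ ∈ Subgroup.upperCentralSeries G (1 + 1)
  rw [Subgroup.mem_upperCentralSeries_succ_iff]
  intro x
  rw [Subgroup.upperCentralSeries_one]
  have hc := mul_mem (hα (g * x * g⁻¹)) (inv_mem (hβ (h * x * h⁻¹)))
  rw [heq x] at hc
  have hn := Subgroup.Normal.conj_mem inferInstance _ (inv_mem hc) (x * h⁻¹)
  convert hn using 1
  group

theorem card_class_preserving_ge_card_central_mul
    (p : ℕ) (hp : p.Prime) (G : Type*) [Group G] [Finite G]
    (hpG : IsPGroup p G)
    (hZ : ∀ x : G, x ∉ commutator G →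
      ∀ z ∈ Subgroup.center G, ∃ g : G, z = x⁻¹ * g⁻¹ * x * g) :
    Nat.card {α : G ≃* G // ∀ x : G, IsConj x (α x)} ≥
      Nat.card {α : G ≃* G // ∀ x : G, x⁻¹ * α x ∈ Subgroup.center G} *
        Nat.card (G ⧸ upperCentralSeries G 2) := by
  rw [ge_iff_le, ← Nat.card_prod]
  have : Finite (G ≃* G) := Finite.of_injective _ DFunLike.coe_injective
  let f : {α : G ≃* G // ∀ x : G, x⁻¹ * α x ∈ Subgroup.center G} × (G ⧸ upperCentralSeries G 2) →
      {α : G ≃* G // ∀ x : G, IsConj x (α x)} := fun a =>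
    ⟨(MulAut.conj a.2.out).trans a.1.1, fun x =>
      (isConj_iff.2 ⟨a.2.out, rfl⟩).trans (a.1.1.isConj_apply_of_central hZ a.1.2 _)⟩
  refine Nat.card_le_card_of_injective f ?_
  rintro ⟨⟨α, hα⟩, q⟩ ⟨⟨β, hβ⟩, r⟩ hf
  have heq (x : G) : α (q.out * x * q.out⁻¹) = β (r.out * x * r.out⁻¹) :=
    DFunLike.congr_fun (congrArg Subtype.val hf) x
  have hqr : r = q := by
    rw [← r.out_eq', ← q.out_eq']
    exact QuotientGroup.eq.2 (inv_mul_mem_upperCentralSeries_two hα hβ heq)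
  subst hqr
  have hαβ : α = β := by
    ext x
    simpa [mul_assoc] using heq (r.out⁻¹ * x * r.out)
  subst hαβ
  rfl
end

section
/- Let G be a purely non-abelian finite group, i.e., a non-abelian finite group admitting no decomposition G ≅ A × H with A a nontrivial abelian group. Then the number of central automorphisms of G equals the number of group homomorphisms from G/γ₂(G) to Z(G), where γ₂(G) is the commutator subgroup of G and Z(G) is the center of G. -/
section CentralAutomorphisms

variable {G : Type*} [Group G]

/-- Some positive power of an element of a finite monoid is idempotent. -/
theorem exists_pos_isIdempotentElem_pow {M : Type*} [Monoid M] [Finite M] (a : M) :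
    ∃ n, 0 < n ∧ IsIdempotentElem (a ^ n) := by
  obtain ⟨i, j, hij, h⟩ : ∃ i j : ℕ, i < j ∧ a ^ i = a ^ j := by
    obtain ⟨i, j, hne, h⟩ := Finite.exists_ne_map_eq_of_infinite (fun n : ℕ => a ^ n)
    rcases lt_or_gt_of_ne hne with hlt | hlt
    exacts [⟨i, j, hlt, h⟩, ⟨j, i, hlt, h.symm⟩]
  obtain ⟨d, rfl⟩ := Nat.exists_eq_add_of_lt hij
  have period (k m : ℕ) (hm : i ≤ m) : a ^ (m + k * (d + 1)) = a ^ m := by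
    induction k with
    | zero => simp
    | succ k ih =>
      obtain ⟨c, rfl⟩ := Nat.exists_eq_add_of_le hm
      rw [← ih, show i + c + (k + 1) * (d + 1) = (i + d + 1) + (c + k * (d + 1)) by ring,
        pow_add, ← h, ← pow_add, add_assoc]
  refine ⟨(i + 1) * (d + 1), by positivity, ?_⟩
  rw [IsIdempotentElem, ← pow_add]
  exact period (i + 1) _ (by nlinarith)

/-- An idempotent endomorphism with central image splits the group as a direct product. -/
def mulEquivRangeProdKerOfIdempotent (e : G →* G) (he : ∀ x, e (e x) = e x)
    (hc : ∀ x, e x ∈ Subgroup.center G) :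
    G ≃* e.range × e.ker where
  toFun x := (⟨e x, x, rfl⟩, ⟨(e x)⁻¹ * x, MonoidHom.mem_ker.2 (by simp [he])⟩)
  invFun p := p.1 * p.2
  left_inv x := by simp
  right_inv := by
    rintro ⟨⟨_, y, rfl⟩, ⟨k, hk⟩⟩
    have hek : e k = 1 := hk
    simp [he, hek]
  map_mul' x y := by
    have hx := Subgroup.mem_center_iff.1 (inv_mem (hc y)) ((e x)⁻¹ * x)
    refine Prod.ext (Subtype.ext (map_mul e x y)) (Subtype.ext ?_)
    simp only [map_mul, mul_inv_rev, Prod.mk_mul_mk, MulMemClass.mk_mul_mk]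
    rw [← mul_assoc ((e x)⁻¹ * x), hx, ← mul_assoc, ← mul_assoc]

/-- The endomorphism `x ↦ x * f x` attached to a homomorphism into the center. -/
def centralEnd (f : G →* Subgroup.center G) : G →* G where
  toFun x := x * f x
  map_one' := by simp
  map_mul' x y := by
    have h := Subgroup.mem_center_iff.1 (f x).2 y
    simp only [map_mul, Subgroup.coe_mul]
    rw [mul_assoc x y, ← mul_assoc y, h]
    simp only [mul_assoc]

/-- The homomorphism `x ↦ x⁻¹ * α x` into the center attached to a central automorphism. -/
def centralDisplacement (α : G ≃* G) (hα : ∀ x, x⁻¹ * α x ∈ Subgroup.center G) :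
    G →* Subgroup.center G where
  toFun x := ⟨x⁻¹ * α x, hα x⟩
  map_one' := by simp
  map_mul' x y := Subtype.ext <| by
    have h := Subgroup.mem_center_iff.1 (hα x) y⁻¹
    simp only [map_mul, mul_inv_rev, Subgroup.coe_mul]
    rw [← mul_assoc _ y⁻¹, ← h]
    simp only [mul_assoc]

theorem centralEnd_injective {G : Type u} [Group G] [Finite G]
    (hpure : ¬ ∃ (A H : Type u) (_ : CommGroup A) (_ : Group H),
      Nontrivial A ∧ Nonempty (G ≃* A × H)) (f : G →* Subgroup.center G) :
    Function.Injective (centralEnd f) := by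
  let h : Monoid.End G := (Subgroup.center G).subtype.comp f
  have : Finite (Monoid.End G) :=
    Finite.of_injective (fun f : Monoid.End G => (f : G → G)) DFunLike.coe_injective
  obtain ⟨n, hn, he⟩ := exists_pos_isIdempotentElem_pow h
  have hc (x : G) : (h ^ n) x ∈ Subgroup.center G := by
    obtain ⟨m, rfl⟩ := Nat.exists_eq_succ_of_ne_zero hn.ne'
    rw [pow_succ']
    exact (f ((h ^ m) x)).2
  have htriv (x : G) : (h ^ n) x = 1 := by
    by_contra hx
    refine hpure ⟨MonoidHom.range (h ^ n : G →* G), MonoidHom.ker (h ^ n : G →* G),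
      { mul_comm := ?_ }, inferInstance, ?_, ⟨mulEquivRangeProdKerOfIdempotent _ (DFunLike.congr_fun he) hc⟩⟩
    · rintro a ⟨_, y, rfl⟩
      exact Subtype.ext (Subgroup.mem_center_iff.1 (hc y) a)
    · exact ⟨⟨⟨_, x, rfl⟩, 1, fun hx' => hx (congrArg Subtype.val hx')⟩⟩
  refine (injective_iff_map_eq_one _).2 fun x hx => ?_
  have hinv : h x = x⁻¹ := eq_inv_of_mul_eq_one_right hx
  have hpow (m : ℕ) : (h ^ m) x = x ∨ (h ^ m) x = x⁻¹ := by
    induction m with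
    | zero => exact Or.inl rfl
    | succ m ih =>
      rw [pow_succ']
      change h ((h ^ m) x) = x ∨ h ((h ^ m) x) = x⁻¹
      rcases ih with ih | ih <;> simp [ih, hinv]
  rcases hpow n with hxn | hxn <;> simpa [htriv] using hxn.symm

/-- In a purely non-abelian finite group, central automorphisms correspond to homomorphisms
into the center. -/
noncomputable def centralAutEquivHom {G : Type u} [Group G] [Finite G]
    (hpure : ¬ ∃ (A H : Type u) (_ : CommGroup A) (_ : Group H),
      Nontrivial A ∧ Nonempty (G ≃* A × H)) :
    {α : G ≃* G // ∀ x : G, x⁻¹ * α x ∈ Subgroup.center G} ≃ (G →* Subgroup.center G) where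
  toFun α := centralDisplacement α.1 α.2
  invFun f := ⟨MulEquiv.ofBijective (centralEnd f)
    (Finite.injective_iff_bijective.1 (centralEnd_injective hpure f)), fun x => by
      simp [centralEnd]⟩
  left_inv α := Subtype.ext <| MulEquiv.ext fun x => by
    simp [centralEnd, centralDisplacement]
  right_inv f := MonoidHom.ext fun x => Subtype.ext <| by
    simp [centralEnd, centralDisplacement]

end CentralAutomorphisms


/-- (Adney–Yen) If `G` is a purely non-abelian finite group, then the number of central
automorphisms of `G` equals the number of homomorphisms from `G/γ₂(G)` to `Z(G)`. -/
theorem card_central_aut_eq_card_hom_of_purely_nonabelian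
    {G : Type u} [Group G] [Finite G]
    (hna : ¬ ∀ a b : G, a * b = b * a)
    (hpure : ¬ ∃ (A H : Type u) (_ : CommGroup A) (_ : Group H),
        Nontrivial A ∧ Nonempty (G ≃* A × H)) :
    Nat.card {α : G ≃* G // ∀ x : G, x⁻¹ * α x ∈ Subgroup.center G} =
      Nat.card ((G ⧸ commutator G) →* Subgroup.center G) := by
  let _ : CommGroup (Subgroup.center G) :=
    { mul_comm := fun a b => Subtype.ext (Subgroup.mem_center_iff.1 b.2 a) }
  exact Nat.card_congr ((centralAutEquivHom hpure).trans
    (Abelianization.lift (G := G) (A := Subgroup.center G)))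
end

section
/- Let p be a prime and let G be a finite extraspecial p-group, i.e., a non-abelian finite p-group such that the center Z(G), the commutator subgroup γ₂(G), and the Frattini subgroup Φ(G) coincide and have order p. Then every class preserving automorphism of G is inner. -/
/-- A finite abelian group has at most as many homomorphisms into a finite cyclic group
as it has elements. -/
theorem card_monoidHom_le_of_isCyclic (A C : Type*) [CommGroup A] [Finite A] [CommGroup C]
    [Finite C] [IsCyclic C] : Nat.card (A →* C) ≤ Nat.card A := by
  have : NeZero (Nat.card C) := ⟨Nat.card_pos.ne'⟩
  have : NeZero (Monoid.exponent A) := ⟨Monoid.exponent_ne_zero_of_finite⟩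
  have hcard : Nat.card C = Nat.card (rootsOfUnity (Nat.card C) ℂ) := by
    rw [Complex.card_rootsOfUnity]
  let e : C ≃* rootsOfUnity (Nat.card C) ℂ := mulEquivOfCyclicCardEq hcard
  have hfin : Finite (A →* ℂˣ) := Nat.finite_of_card_ne_zero <| by
    rw [CommGroup.card_monoidHom_of_hasEnoughRootsOfUnity A ℂ]
    exact Nat.card_pos.ne'
  rw [← CommGroup.card_monoidHom_of_hasEnoughRootsOfUnity A ℂ]
  refine Nat.card_le_card_of_injective
    (fun f : A →* C ↦ ((rootsOfUnity (Nat.card C) ℂ).subtype.comp e.toMonoidHom).comp f) ?_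
  intro f g hfg
  ext x
  exact e.injective (Subtype.ext (DFunLike.congr_fun hfg x))

/-- The map `x ↦ ⁅x⁻¹, g⁻¹⁆` into the center of a group whose commutators are central. -/
def commutatorHomToCenter {G : Type*} [Group G] (h : commutator G ≤ Subgroup.center G) (g : G) :
    G →* Subgroup.center G :=
  MonoidHom.mk' (fun x ↦ ⟨x⁻¹ * g⁻¹ * x * g, h <| by
    simpa [commutator_def, commutatorElement_def] using
      Subgroup.commutator_mem_commutator (Subgroup.mem_top x⁻¹) (Subgroup.mem_top g⁻¹)⟩) <| by
    intro x y
    have hx : x⁻¹ * g⁻¹ * x * g ∈ Subgroup.center G := h <| by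
      simpa [commutator_def, commutatorElement_def] using
        Subgroup.commutator_mem_commutator (Subgroup.mem_top x⁻¹) (Subgroup.mem_top g⁻¹)
    ext
    have := Subgroup.mem_center_iff.mp hx y⁻¹
    simp only [Subgroup.coe_mul]
    calc (x * y)⁻¹ * g⁻¹ * (x * y) * g
        = y⁻¹ * (x⁻¹ * g⁻¹ * x * g) * (g⁻¹ * y * g) := by group
      _ = (x⁻¹ * g⁻¹ * x * g) * (y⁻¹ * g⁻¹ * y * g) := by rw [this]; group

@[simp]
theorem coe_commutatorHomToCenter_apply {G : Type*} [Group G]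
    (h : commutator G ≤ Subgroup.center G) (g x : G) :
    (commutatorHomToCenter h g x : G) = x⁻¹ * g⁻¹ * x * g := rfl

open scoped IsMulCommutative in
/-- If the center of a finite group is cyclic and equal to the commutator subgroup, then every
homomorphism into the center is given by commutators with a fixed element. -/
theorem commutatorHomToCenter_surjective {G : Type*} [Group G] [Finite G]
    (h : Subgroup.center G = commutator G) [IsCyclic (Subgroup.center G)] :
    Function.Surjective (commutatorHomToCenter h.ge) := by
  have hinj : Function.Injective
      fun q : G ⧸ Subgroup.center G ↦ commutatorHomToCenter h.ge q.out := by
    intro a b hab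
    rw [← QuotientGroup.out_eq' a, ← QuotientGroup.out_eq' b]
    refine QuotientGroup.eq.mpr (Subgroup.Normal.mem_comm inferInstance ?_)
    refine Subgroup.mem_center_iff.mpr fun x ↦ ?_
    have hx := congrArg Subtype.val (DFunLike.congr_fun hab x)
    simp only [coe_commutatorHomToCenter_apply, mul_assoc, mul_right_inj] at hx
    calc x * (b.out * a.out⁻¹)
        = b.out * (b.out⁻¹ * (x * b.out)) * a.out⁻¹ := by group
      _ = b.out * a.out⁻¹ * x := by rw [← hx]; group
  have hfin : Finite (G →* Subgroup.center G) := DFunLike.finite _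
  have hle : Nat.card (G →* Subgroup.center G) ≤ Nat.card (G ⧸ Subgroup.center G) := by
    rw [Nat.card_congr (Abelianization.lift (G := G) (A := Subgroup.center G))]
    have hindex : Nat.card (Abelianization G) = Nat.card (G ⧸ Subgroup.center G) := by
      rw [h]
      rfl
    exact (card_monoidHom_le_of_isCyclic (Abelianization G) _).trans_eq hindex
  intro f
  obtain ⟨q, hq⟩ := (hinj.bijective_of_nat_card_le hle).2 f
  exact ⟨q.out, hq⟩

/-- Every class preserving automorphism of a finite extraspecial `p`-group is inner. -/
theorem class_preserving_inner_of_extraspecial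
    (p : ℕ) (hp : p.Prime) (G : Type*) [Group G] [Finite G]
    (hpG : IsPGroup p G)
    (hna : ¬ ∀ a b : G, a * b = b * a)
    (hZc : Subgroup.center G = commutator G)
    (hcf : commutator G = frattini G)
    (hcard : Nat.card (Subgroup.center G) = p) :
    ∀ α : G ≃* G, (∀ x : G, IsConj x (α x)) →
      ∃ g : G, ∀ x : G, α x = g⁻¹ * x * g := by
  intro α hα
  have : Fact p.Prime := ⟨hp⟩
  have : IsCyclic (Subgroup.center G) := isCyclic_of_prime_card hcard
  have hmem (x : G) : x⁻¹ * α x ∈ Subgroup.center G := by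
    obtain ⟨c, hc⟩ := isConj_iff.mp (hα x)
    rw [hZc, ← hc]
    simpa [commutator_def, commutatorElement_def, mul_assoc] using
      Subgroup.commutator_mem_commutator (Subgroup.mem_top x⁻¹) (Subgroup.mem_top c)
  let f : G →* Subgroup.center G := MonoidHom.mk' (fun x ↦ ⟨x⁻¹ * α x, hmem x⟩) <| by
    intro x y
    ext
    have := Subgroup.mem_center_iff.mp (hmem x) y⁻¹
    simp only [Subgroup.coe_mul, map_mul]
    calc (x * y)⁻¹ * (α x * α y) = y⁻¹ * (x⁻¹ * α x) * α y := by group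
      _ = x⁻¹ * α x * (y⁻¹ * α y) := by rw [this]; group
  obtain ⟨g, hg⟩ := commutatorHomToCenter_surjective hZc f
  refine ⟨g, fun x ↦ ?_⟩
  have hx : x⁻¹ * g⁻¹ * x * g = x⁻¹ * α x := congrArg Subtype.val (DFunLike.congr_fun hg x)
  simpa only [mul_assoc, mul_right_inj] using hx.symm
end

section
/- Every class preserving automorphism of the dihedral group of order 32 is inner. -/
namespace DihedralGroup

variable {n : ℕ}

/-- Homomorphisms out of a dihedral group agree if they agree on the generators. -/
theorem monoidHom_ext_generators {G : Type*} [Group G] {f g : DihedralGroup n →* G}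
    (hr : f (r 1) = g (r 1)) (hsr : f (sr 0) = g (sr 0)) : f = g := by
  have key (i : ZMod n) : f (r i) = g (r i) := by
    have hi : r i = (r 1 : DihedralGroup n) ^ (i.cast : ℤ) := by simp
    rw [hi, map_zpow, map_zpow, hr]
  ext (i | i)
  · exact key i
  · have hi : sr i = (sr 0 : DihedralGroup n) * r i := by simp
    rw [hi, map_mul, map_mul, hsr, key]

theorem eq_r_or_eq_r_neg_of_isConj {i : ZMod n} {x : DihedralGroup n} (h : IsConj (r i) x) :
    x = r i ∨ x = r (-i) := by
  obtain ⟨c | c, rfl⟩ := isConj_iff.mp h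
  · left; simp
  · right; simp

theorem exists_eq_sr_of_isConj_sr_zero {x : DihedralGroup n} (h : IsConj (sr 0) x) :
    ∃ k, x = sr (k + k) := by
  obtain ⟨c | c, rfl⟩ := isConj_iff.mp h
  · exact ⟨-c, by simp⟩
  · exact ⟨c, by simp⟩

/-- Every class preserving endomorphism of a dihedral group is conjugation by an element. -/
theorem exists_eq_conj_of_forall_isConj (f : DihedralGroup n →* DihedralGroup n)
    (hf : ∀ x, IsConj x (f x)) : ∃ g, ∀ x, f x = g⁻¹ * x * g := by
  obtain ⟨k, hk⟩ := exists_eq_sr_of_isConj_sr_zero (hf (sr 0))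
  have key (g : DihedralGroup n) (hr : f (r 1) = g⁻¹ * r 1 * g)
      (hsr : f (sr 0) = g⁻¹ * sr 0 * g) (x) : f x = g⁻¹ * x * g := by
    have : f = (MulAut.conj g⁻¹).toMonoidHom :=
      monoidHom_ext_generators (by simpa using hr) (by simpa using hsr)
    simp [this]
  rcases eq_r_or_eq_r_neg_of_isConj (hf (r 1)) with h | h
  · exact ⟨r k, key _ (by simp [h]) (by simp [hk])⟩
  · exact ⟨sr k, key _ (by simp [h]) (by simp [hk])⟩

end DihedralGroup

/-- Every class preserving automorphism of the dihedral group of order 32 is inner. -/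
theorem class_preserving_inner_dihedral32 :
    ∀ α : DihedralGroup 16 ≃* DihedralGroup 16,
      (∀ x : DihedralGroup 16, IsConj x (α x)) →
      ∃ g : DihedralGroup 16, ∀ x : DihedralGroup 16, α x = g⁻¹ * x * g :=
  fun α hα => DihedralGroup.exists_eq_conj_of_forall_isConj α.toMonoidHom hα
end

section
/- Every class preserving automorphism of the generalized quaternion group of order 32 is inner. -/
namespace QuaternionGroup

/-- Homomorphisms out of a generalized quaternion group are determined by the generators. -/
theorem monoidHom_eq_of_eq_on_generators {n : ℕ} [NeZero n] {M : Type*} [Monoid M]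
    {f g : QuaternionGroup n →* M} (ha : f (a 1) = g (a 1)) (hx : f (xa 0) = g (xa 0)) :
    f = g := by
  have key (i : ZMod (2 * n)) : f (a i) = g (a i) := by
    have hi : (a i : QuaternionGroup n) = a 1 ^ i.val := by
      rw [a_one_pow, ZMod.natCast_zmod_val]
    rw [hi, map_pow, map_pow, ha]
  ext (i | i)
  · exact key i
  · have hi : (xa i : QuaternionGroup n) = xa 0 * a i := by simp
    rw [hi, map_mul, map_mul, hx, key]

/-- The conjugates of `a i` are `a i` and `a (-i)`. -/
theorem conj_a_eq {n : ℕ} (c : QuaternionGroup n) (i : ZMod (2 * n)) :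
    c * a i * c⁻¹ = a i ∨ c * a i * c⁻¹ = a (-i) := by
  obtain j | j := c
  · left
    rw [mul_inv_eq_iff_eq_mul]
    simp [add_comm]
  · right
    rw [mul_inv_eq_iff_eq_mul]
    simp [add_comm]

/-- Every class preserving automorphism of a generalized quaternion group is inner. -/
theorem exists_eq_conj_of_forall_isConj {n : ℕ} [NeZero n]
    (α : QuaternionGroup n ≃* QuaternionGroup n) (hα : ∀ x, IsConj x (α x)) :
    ∃ c, ∀ x, α x = c * x * c⁻¹ := by
  suffices h : ∃ c, α (a 1) = c * a 1 * c⁻¹ ∧ α (xa 0) = c * xa 0 * c⁻¹ by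
    obtain ⟨c, ha, hx⟩ := h
    exact ⟨c, DFunLike.congr_fun (monoidHom_eq_of_eq_on_generators
      (f := α.toMonoidHom) (g := (MulAut.conj c).toMonoidHom) ha hx)⟩
  obtain ⟨c, hc⟩ := isConj_iff.mp (hα (xa 0))
  obtain ⟨d, hd⟩ := isConj_iff.mp (hα (a 1))
  have hk : α (a 1) = c * ((c⁻¹ * d) * a 1 * (c⁻¹ * d)⁻¹) * c⁻¹ := by
    rw [← hd]
    group
  obtain h | h := conj_a_eq (c⁻¹ * d) 1
  · exact ⟨c, by rw [hk, h], hc.symm⟩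
  · refine ⟨c * xa 0, ?_, by rw [← hc]; group⟩
    have hx : (a (-1) : QuaternionGroup n) = xa 0 * a 1 * (xa 0)⁻¹ := by
      rw [eq_mul_inv_iff_mul_eq]
      simp
    rw [hk, h, hx]
    group

end QuaternionGroup

/-- Every class preserving automorphism of the generalized quaternion group of order 32
is inner. -/
theorem class_preserving_inner_quaternion32 :
    ∀ α : QuaternionGroup 8 ≃* QuaternionGroup 8,
      (∀ x : QuaternionGroup 8, IsConj x (α x)) →
      ∃ g : QuaternionGroup 8, ∀ x : QuaternionGroup 8, α x = g⁻¹ * x * g := by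
  intro α hα
  obtain ⟨c, hc⟩ := QuaternionGroup.exists_eq_conj_of_forall_isConj α hα
  exact ⟨c⁻¹, fun x => by rw [hc, inv_inv]⟩
end

section
/- Every class preserving automorphism of the group G = D₁₆ × C₂, the direct product of the dihedral group of order 16 with the cyclic group of order 2 (a group of order 32), is inner. -/
namespace DihedralGroup

variable {n : ℕ} {A : Type*} [CommGroup A]

/-- A homomorphism out of `DihedralGroup n × A` is determined by its values on the standard
generators of `DihedralGroup n` and on `A`. -/
theorem prod_monoidHom_ext {H : Type*} [Group H] {f g : DihedralGroup n × A →* H}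
    (hr : f (r 1, 1) = g (r 1, 1)) (hs : f (sr 0, 1) = g (sr 0, 1))
    (hA : ∀ a, f (1, a) = g (1, a)) : f = g := by
  have hrot : ∀ i a, f (r i, a) = g (r i, a) := by
    intro i a
    obtain ⟨k, rfl⟩ := ZMod.intCast_surjective i
    have h : ((r (k : ZMod n), a) : DihedralGroup n × A) = (r 1, 1) ^ k * (1, a) := by
      ext <;> simp
    rw [h, map_mul, map_mul, map_zpow, map_zpow, hr, hA]
  ext ⟨i | i, a⟩
  · exact hrot i a
  · have h : ((sr i, a) : DihedralGroup n × A) = (sr 0, 1) * (r i, a) := by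
      ext <;> simp
    rw [h, map_mul, map_mul, hs, hrot]

/-- For conjugators `c` and `d`, the rotation `r i` has the same image under conjugation by `d` as
under conjugation by `c` or by `c * sr 0`. -/
theorem conj_r_eq_or (c d : DihedralGroup n) (i : ZMod n) :
    d * r i * d⁻¹ = c * r i * c⁻¹ ∨ d * r i * d⁻¹ = c * sr 0 * r i * (c * sr 0)⁻¹ := by
  rcases c with c | c <;> rcases d with d | d <;> simp

/-- Every class preserving automorphism of the product of a dihedral group and an abelian group is
inner. -/
theorem exists_eq_conj_of_isConj (α : DihedralGroup n × A ≃* DihedralGroup n × A)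
    (hα : ∀ x, IsConj x (α x)) : ∃ g, ∀ x, α x = g⁻¹ * x * g := by
  obtain ⟨c, hc⟩ := isConj_iff.1 (hα (sr 0, 1))
  obtain ⟨d, hd⟩ := isConj_iff.1 (hα (r 1, 1))
  have key : ∀ g, α (r 1, 1) = g * (r 1, 1) * g⁻¹ → α (sr 0, 1) = g * (sr 0, 1) * g⁻¹ →
      ∃ g, ∀ x, α x = g⁻¹ * x * g := by
    intro g hr hs
    have h : α.toMonoidHom = (MulAut.conj g).toMonoidHom := by
      refine prod_monoidHom_ext (by simpa using hr) (by simpa using hs) fun a => ?_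
      obtain ⟨e, he⟩ := isConj_iff.1 (hα (1, a))
      have hcentral : ∀ y : DihedralGroup n × A, y * (1, a) * y⁻¹ = (1, a) := by
        intro y
        ext <;> simp
      simp only [MulEquiv.toMonoidHom_eq_coe, MonoidHom.coe_coe, MulAut.conj_apply]
      rw [← he, hcentral, hcentral]
    exact ⟨g⁻¹, fun x => by simpa using DFunLike.congr_fun h x⟩
  rcases conj_r_eq_or c.1 d.1 1 with h | h
  · refine key c ?_ hc.symm
    rw [← hd]
    exact Prod.ext h (by simp)
  · refine key (c * (sr 0, 1)) ?_ ?_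
    · rw [← hd]
      exact Prod.ext h (by simp)
    · rw [← hc]
      group

end DihedralGroup

/-- Every class preserving automorphism of `D₁₆ × C₂` (of order 32) is inner. -/
theorem class_preserving_inner_dihedral16_prod_C2 :
    ∀ α : (DihedralGroup 8 × Multiplicative (ZMod 2)) ≃*
          (DihedralGroup 8 × Multiplicative (ZMod 2)),
      (∀ x : DihedralGroup 8 × Multiplicative (ZMod 2), IsConj x (α x)) →
      ∃ g : DihedralGroup 8 × Multiplicative (ZMod 2),
        ∀ x : DihedralGroup 8 × Multiplicative (ZMod 2), α x = g⁻¹ * x * g :=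
  DihedralGroup.exists_eq_conj_of_isConj
end
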